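/- Let G be a finite simple graph with mad(G) < 18/7 and ch_3^d(G) > 6 such that every proper subgraph H of G (obtained from G by deleting at least one vertex or at least one edge) satisfies ch_3^d(H) ≤ 6. Then no vertex of W_1(G) has two neighbors in W_2(G). -/

import Mathlib

open SimpleGraph

/-- `φ` is a proper coloring of `G` that is 3-dynamic: every vertex `v` sees at least
`min 3 (deg v)` distinct colors on its neighborhood. -/
def IsDyn3Coloring {V : Type*} (G : SimpleGraph V) (φ : V → ℕ) : Prop :=
  (∀ u v, G.Adj u v → φ u ≠ φ v) ∧
  ∀ v, min 3 (G.neighborSet v).ncard ≤ (φ '' G.neighborSet v).ncard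

/-- `G` is 3-dynamically colorable from the list assignment `L`. -/
def Dyn3ListColorable {V : Type*} (G : SimpleGraph V) (L : V → Finset ℕ) : Prop :=
  ∃ φ : V → ℕ, IsDyn3Coloring G φ ∧ ∀ v, φ v ∈ L v

/-- `ch_3^d(G) ≤ k` : `G` is 3-dynamically `L`-colorable for every list assignment `L`
with `|L v| ≥ k` for all `v`. -/
def Ch3dLE {V : Type*} (G : SimpleGraph V) (k : ℕ) : Prop :=
  ∀ L : V → Finset ℕ, (∀ v, k ≤ (L v).card) → Dyn3ListColorable G L

/-- `mad(G) < c` : every nonempty subgraph has average degree `< c`. -/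
def MadLT {V : Type*} (G : SimpleGraph V) (c : ℚ) : Prop :=
  ∀ H : G.Subgraph, H.verts.Nonempty →
    (2 * H.edgeSet.ncard : ℚ) / (H.verts.ncard : ℚ) < c

/-- `mad(G) ≤ c` : every nonempty subgraph has average degree `≤ c`. -/
def MadLE {V : Type*} (G : SimpleGraph V) (c : ℚ) : Prop :=
  ∀ H : G.Subgraph, H.verts.Nonempty →
    (2 * H.edgeSet.ncard : ℚ) / (H.verts.ncard : ℚ) ≤ c

/-- Every proper subgraph of `G` (deleting at least one vertex or edge) has
`ch_3^d ≤ k`. -/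
def ProperSubgraphsCh3dLE {V : Type*} (G : SimpleGraph V) (k : ℕ) : Prop :=
  ∀ H : G.Subgraph, H ≠ ⊤ → Ch3dLE H.coe k

/-- `x ∈ W_i(G)` : `x` has degree 3 and exactly `i` neighbors of degree 2. -/
def Wmem {V : Type*} (G : SimpleGraph V) (i : ℕ) (x : V) : Prop :=
  (G.neighborSet x).ncard = 3 ∧
    {y | G.Adj x y ∧ (G.neighborSet y).ncard = 2}.ncard = i

/-- `y` is a weak neighbor of `x` : they are distinct and have a common neighbor of
degree 2. -/
def WeakAdj {V : Type*} (G : SimpleGraph V) (x y : V) : Prop :=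
  x ≠ y ∧ ∃ w, G.Adj x w ∧ G.Adj y w ∧ (G.neighborSet w).ncard = 2


def GoodP {V : Type*} (G : SimpleGraph V) (L : V → Finset ℕ) (c : V → ℕ) (D : Set V) : Prop :=
  (∀ u v, u ∈ D → v ∈ D → G.Adj u v → c u ≠ c v) ∧
  (∀ w, min 3 ({u | G.Adj w u ∧ u ∈ D}).ncard ≤ (c '' {u | G.Adj w u ∧ u ∈ D}).ncard) ∧
  (∀ v ∈ D, c v ∈ L v)

theorem goodP_step {V : Type*} [Fintype V] {G : SimpleGraph V} {L : V → Finset ℕ} {c : V → ℕ}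
    {D : Set V} (h : GoodP G L c D) (v : V) (hv : v ∉ D) (α : ℕ) (hα : α ∈ L v)
    (h1 : ∀ w, G.Adj v w → w ∈ D → c w ≠ α)
    (h2 : ∀ w, G.Adj v w → (c '' {u | G.Adj w u ∧ u ∈ D}).ncard < 3 →
      ∀ u ∈ D, G.Adj w u → c u ≠ α) :
    ∃ c', GoodP G L c' (insert v D) ∧ (∀ u ∈ D, c' u = c u) ∧ c' v = α := by
  classical
  obtain ⟨g1, g2, g3⟩ := h
  have hag : ∀ u ∈ D, Function.update c v α u = c u := by
    intro u hu
    have : u ≠ v := by rintro rfl; exact hv hu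
    simp [this]
  have hvv : Function.update c v α v = α := by simp
  refine ⟨Function.update c v α, ⟨?_, ?_, ?_⟩, hag, hvv⟩
  · intro a b ha hb hab
    rcases ha with rfl | ha <;> rcases hb with rfl | hb
    · exact absurd hab (G.loopless.irrefl _)
    · rw [hvv, hag _ hb]; exact (h1 _ hab hb).symm
    · rw [hvv, hag _ ha]; exact h1 _ hab.symm ha
    · rw [hag _ ha, hag _ hb]; exact g1 _ _ ha hb hab
  · intro w
    have him : Function.update c v α '' {u | G.Adj w u ∧ u ∈ D} = c '' {u | G.Adj w u ∧ u ∈ D} :=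
      Set.image_congr (fun u hu => hag u hu.2)
    by_cases hw : G.Adj w v
    · have hset : {u | G.Adj w u ∧ u ∈ insert v D} = insert v {u | G.Adj w u ∧ u ∈ D} := by
        ext u; simp only [Set.mem_ofPred_eq, Set.mem_insert_iff]
        constructor
        · rintro ⟨a, rfl | b⟩ <;> simp_all
        · rintro (rfl | ⟨a, b⟩) <;> simp_all
      have hnm : v ∉ {u | G.Adj w u ∧ u ∈ D} := fun hh => hv hh.2
      rw [hset, Set.image_insert_eq, him, hvv, Set.ncard_insert_of_notMem hnm (Set.toFinite _)]
      by_cases hlt : (c '' {u | G.Adj w u ∧ u ∈ D}).ncard < 3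
      · have : α ∉ c '' {u | G.Adj w u ∧ u ∈ D} := by
          rintro ⟨u, ⟨hu1, hu2⟩, hu3⟩
          exact h2 w hw.symm hlt u hu2 hu1 hu3
        rw [Set.ncard_insert_of_notMem this (Set.toFinite _)]
        have := g2 w
        omega
      · have := Set.ncard_le_ncard (Set.subset_insert α (c '' {u | G.Adj w u ∧ u ∈ D}))
          (Set.toFinite _)
        omega
    · have hset : {u | G.Adj w u ∧ u ∈ insert v D} = {u | G.Adj w u ∧ u ∈ D} := by
        ext u; simp only [Set.mem_ofPred_eq, Set.mem_insert_iff]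
        constructor
        · rintro ⟨a, rfl | b⟩ <;> simp_all
        · rintro ⟨a, b⟩; simp_all
      rw [hset, him]; exact g2 w
  · intro u hu
    rcases hu with rfl | hu
    · rw [hvv]; exact hα
    · rw [hag _ hu]; exact g3 _ hu

theorem goodP_stepF {V : Type*} [Fintype V] {G : SimpleGraph V} {L : V → Finset ℕ} {c : V → ℕ}
    {D : Set V} (hL : ∀ v, (L v).card = 6) (h : GoodP G L c D) (v p : V)
    (hF : v ∉ D → v ≠ p → ∃ F : Finset ℕ, F.card ≤ 5 ∧ ∀ w, G.Adj v w → (w ∈ D → c w ∈ F) ∧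
      ((c '' {u | G.Adj w u ∧ u ∈ D}).ncard < 3 → ∀ u ∈ D, G.Adj w u → c u ∈ F)) :
    ∃ c', GoodP G L c' (D ∪ {u | u = v ∧ u ≠ p}) ∧ (∀ u ∈ D, c' u = c u) := by
  by_cases hv : v ∈ D
  · have : D ∪ {u | u = v ∧ u ≠ p} = D := by ext u; simp; rintro rfl _; exact hv
    rw [this]; exact ⟨c, h, fun _ _ => rfl⟩
  by_cases hp : v = p
  · have : D ∪ {u | u = v ∧ u ≠ p} = D := by ext u; simp; rintro rfl h; exact absurd hp h
    rw [this]; exact ⟨c, h, fun _ _ => rfl⟩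
  obtain ⟨F, hFc, hF⟩ := hF hv hp
  obtain ⟨α, ha, hb⟩ : ∃ α ∈ L v, α ∉ F := by
    apply Finset.exists_mem_notMem_of_card_lt_card
    rw [hL]; omega
  have : D ∪ {u | u = v ∧ u ≠ p} = insert v D := by
    ext u; simp; constructor
    · rintro (h | ⟨h, _⟩) <;> simp [h]
    · rintro (rfl | h) <;> simp_all
  rw [this]
  obtain ⟨c', h1, h2, _⟩ := goodP_step h v hv α ha
    (fun w hw hwD he => hb (he ▸ (hF w hw).1 hwD))
    (fun w hw hlt u hu hwu he => hb (he ▸ (hF w hw).2 hlt u hu hwu))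
  exact ⟨c', h1, h2⟩

theorem outerK {V : Type*} [Fintype V] (G : SimpleGraph V) (c : V → ℕ) (D : Set V) (w : V) :
    ∃ K : Finset ℕ, K.card ≤ 3 ∧ c w ∈ K ∧
      ((c '' {u | G.Adj w u ∧ u ∈ D}).ncard < 3 → ∀ u ∈ D, G.Adj w u → c u ∈ K) := by
  classical
  by_cases h : (c '' {u | G.Adj w u ∧ u ∈ D}).ncard < 3
  · refine ⟨insert (c w) (c '' {u | G.Adj w u ∧ u ∈ D}).toFinset, ?_, by simp, ?_⟩
    · refine (Finset.card_insert_le _ _).trans ?_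
      rw [← Set.ncard_eq_toFinset_card']; omega
    · intro _ u hu hwu
      simp only [Finset.mem_insert, Set.mem_toFinset]
      exact Or.inr ⟨u, ⟨hwu, hu⟩, rfl⟩
  · exact ⟨{c w}, by simp, by simp, fun h' => absurd h' h⟩

theorem goodP_init {V : Type*} [Fintype V] {G : SimpleGraph V} (hmin : ProperSubgraphsCh3dLE G 6)
    (L : V → Finset ℕ) (hL : ∀ v, (L v).card = 6) (D : Set V) (x : V) (hx : x ∉ D)
    (hout : ∀ w, w ∉ D → ∃ t, ∀ u, G.Adj w u → u ∈ D → u = t) :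
    ∃ c, GoodP G L c D := by
  classical
  have hne : (⊤ : G.Subgraph).induce D ≠ ⊤ := by
    intro h
    have : x ∈ ((⊤ : G.Subgraph).induce D).verts := by rw [h]; trivial
    exact hx this
  obtain ⟨φ, ⟨p1, p2⟩, p3⟩ := hmin _ hne (fun v => L v.1) (fun v => (hL _).ge)
  let c : V → ℕ := fun v => if h : v ∈ D then φ ⟨v, h⟩ else 0
  have hc : ∀ v (h : v ∈ D), c v = φ ⟨v, h⟩ := fun v h => by simp [c, h]
  refine ⟨c, ?_, ?_, ?_⟩
  · intro u v hu hv huv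
    rw [hc u hu, hc v hv]
    apply p1
    simp [hu, hv, huv]
  · intro w
    by_cases hw : w ∈ D
    · have := p2 ⟨w, hw⟩
      have e1 : {u | G.Adj w u ∧ u ∈ D} = Subtype.val ''
          (((⊤ : G.Subgraph).induce D).coe.neighborSet ⟨w, hw⟩) := by
        ext u; simp [hw]; tauto
      have e2 : c '' {u | G.Adj w u ∧ u ∈ D} = φ ''
          (((⊤ : G.Subgraph).induce D).coe.neighborSet ⟨w, hw⟩) := by
        rw [e1, Set.image_image]
        exact Set.image_congr (fun u _ => hc u.1 u.2)
      rw [e2]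
      rw [e1, Set.ncard_image_of_injective _ Subtype.val_injective]
      exact this
    · obtain ⟨t, ht⟩ := hout w hw
      have hs : ({u | G.Adj w u ∧ u ∈ D}).Subsingleton := by
        intro a ha b hb
        rw [ht a ha.1 ha.2, ht b hb.1 hb.2]
      rw [Set.InjOn.ncard_image (hs.injOn c)]
      exact min_le_right _ _
  · intro v hv
    rw [hc v hv]; exact p3 ⟨v, hv⟩

theorem goodP_fin {V : Type*} {G : SimpleGraph V} {L : V → Finset ℕ} {c : V → ℕ} {D : Set V}
    (hD : ∀ v, v ∈ D) (h : GoodP G L c D) : Dyn3ListColorable G L := by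
  obtain ⟨g1, g2, g3⟩ := h
  refine ⟨c, ⟨fun u v => g1 u v (hD _) (hD _), fun v => ?_⟩, fun v => g3 v (hD v)⟩
  have : {u | G.Adj v u ∧ u ∈ D} = G.neighborSet v := by ext u; simp [hD]
  have h := g2 v
  rwa [this] at h

theorem three_struct {V : Type*} [Fintype V] {G : SimpleGraph V} {y : V}
    (h : Wmem G 2 y) (x : V) (hxy : G.Adj y x) (hx : (G.neighborSet x).ncard = 3) :
    ∃ a b, a ≠ b ∧ (G.neighborSet a).ncard = 2 ∧ (G.neighborSet b).ncard = 2 ∧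
      ∀ t, G.Adj y t ↔ t = x ∨ t = a ∨ t = b := by
  classical
  obtain ⟨h3, h2⟩ := h
  obtain ⟨a, b, hab, hs⟩ := Set.ncard_eq_two.1 h2
  have ha : a ∈ {t | G.Adj y t ∧ (G.neighborSet t).ncard = 2} := by rw [hs]; simp
  have hb : b ∈ {t | G.Adj y t ∧ (G.neighborSet t).ncard = 2} := by rw [hs]; simp
  refine ⟨a, b, hab, ha.2, hb.2, ?_⟩
  have hxa : x ≠ a := by rintro rfl; have := ha.2; omega
  have hxb : x ≠ b := by rintro rfl; have := hb.2; omega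
  have hsub : ({x, a, b} : Set V) ⊆ G.neighborSet y := by
    rintro t (rfl | rfl | rfl)
    · exact hxy
    · exact ha.1
    · exact hb.1
  have heq := Set.eq_of_subset_of_ncard_le hsub
    (by rw [h3, Set.ncard_eq_three.2 ⟨x, a, b, hxa, hxb, hab, rfl⟩]) (Set.toFinite _)
  intro t
  rw [← mem_neighborSet, ← heq]; simp

theorem one_struct {V : Type*} [Fintype V] {G : SimpleGraph V} {x : V}
    (h : Wmem G 1 x) (y z : V) (hyz : y ≠ z) (hxy : G.Adj x y) (hxz : G.Adj x z)
    (hy : (G.neighborSet y).ncard = 3) (hz : (G.neighborSet z).ncard = 3) :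
    ∃ a, (G.neighborSet a).ncard = 2 ∧ ∀ t, G.Adj x t ↔ t = y ∨ t = z ∨ t = a := by
  classical
  obtain ⟨h3, h2⟩ := h
  obtain ⟨a, hs⟩ := Set.ncard_eq_one.1 h2
  have ha : a ∈ {t | G.Adj x t ∧ (G.neighborSet t).ncard = 2} := by rw [hs]; simp
  refine ⟨a, ha.2, ?_⟩
  have hya : y ≠ a := by rintro rfl; have := ha.2; omega
  have hza : z ≠ a := by rintro rfl; have := ha.2; omega
  have hsub : ({y, z, a} : Set V) ⊆ G.neighborSet x := by
    rintro t (rfl | rfl | rfl)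
    · exact hxy
    · exact hxz
    · exact ha.1
  have heq := Set.eq_of_subset_of_ncard_le hsub
    (by rw [h3, Set.ncard_eq_three.2 ⟨y, z, a, hyz, hya, hza, rfl⟩]) (Set.toFinite _)
  intro t
  rw [← mem_neighborSet, ← heq]; simp

theorem two_struct {V : Type*} [Fintype V] {G : SimpleGraph V} {a y : V}
    (h : (G.neighborSet a).ncard = 2) (hay : G.Adj a y) :
    ∃ b, b ≠ y ∧ ∀ t, G.Adj a t ↔ t = y ∨ t = b := by
  classical
  obtain ⟨p, q, hpq, hs⟩ := Set.ncard_eq_two.1 h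
  have hm : ∀ t, G.Adj a t ↔ t = p ∨ t = q := by
    intro t; rw [← mem_neighborSet, hs]; simp
  rcases (hm y).1 hay with rfl | rfl
  · exact ⟨q, hpq.symm, hm⟩
  · exact ⟨p, hpq, fun t => (hm t).trans or_comm⟩

set_option maxHeartbeats 1000000 in
theorem core {V : Type*} [Fintype V] {G : SimpleGraph V} (hmin : ProperSubgraphsCh3dLE G 6)
    (L : V → Finset ℕ) (hL : ∀ v, (L v).card = 6)
    (x y z x1 y1 y2 z1 z2 r p1 p2 q1 q2 : V)
    (hx : ∀ t, G.Adj x t ↔ t = y ∨ t = z ∨ t = x1)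
    (hy : ∀ t, G.Adj y t ↔ t = x ∨ t = y1 ∨ t = y2)
    (hz : ∀ t, G.Adj z t ↔ t = x ∨ t = z1 ∨ t = z2)
    (hx1 : ∀ t, G.Adj x1 t ↔ t = x ∨ t = r)
    (hy1 : ∀ t, G.Adj y1 t ↔ t = y ∨ t = p1)
    (hy2 : ∀ t, G.Adj y2 t ↔ t = y ∨ t = p2)
    (hz1 : ∀ t, G.Adj z1 t ↔ t = z ∨ t = q1)
    (hz2 : ∀ t, G.Adj z2 t ↔ t = z ∨ t = q2)
    (hxy : x ≠ y) (hxz : x ≠ z) (hyz : y ≠ z)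
    (nx1 : x1 ≠ x ∧ x1 ≠ y ∧ x1 ≠ z) (ny1 : y1 ≠ x ∧ y1 ≠ y ∧ y1 ≠ z)
    (ny2 : y2 ≠ x ∧ y2 ≠ y ∧ y2 ≠ z) (nz1 : z1 ≠ x ∧ z1 ≠ y ∧ z1 ≠ z)
    (nz2 : z2 ≠ x ∧ z2 ≠ y ∧ z2 ≠ z) (hyy : y1 ≠ y2) (hzz : z1 ≠ z2)
    (D0 : Set V) (hD0 : ∀ u, u ∈ D0 ↔ u ≠ x ∧ u ≠ y ∧ u ≠ z ∧ u ≠ x1 ∧ u ≠ y1 ∧ u ≠ y2 ∧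
      u ≠ z1 ∧ u ≠ z2)
    (hcrit : (∃ s, ∀ t, G.Adj p1 t → t = y1 ∨ t = s) ∨
      (G.Adj p1 x ∨ G.Adj p1 y ∨ G.Adj p1 y2) ∨
      (p1 ∈ D0 ∧ ∃ a ∈ D0, G.Adj p1 a)) :
    Dyn3ListColorable G L := by
  classical
  obtain ⟨c0, g0⟩ := goodP_init hmin L hL D0 x (by simp [hD0]) (by
    intro w hw
    have : w = x ∨ w = y ∨ w = z ∨ w = x1 ∨ w = y1 ∨ w = y2 ∨ w = z1 ∨ w = z2 := by
      by_contra hcon; push Not at hcon; exact hw ((hD0 w).2 hcon)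
    rcases this with rfl | rfl | rfl | rfl | rfl | rfl | rfl | rfl
    · exact ⟨w, by grind⟩
    · exact ⟨w, by grind⟩
    · exact ⟨w, by grind⟩
    · exact ⟨r, by grind⟩
    · exact ⟨p1, by grind⟩
    · exact ⟨p2, by grind⟩
    · exact ⟨q1, by grind⟩
    · exact ⟨q2, by grind⟩)
  -- step x
  obtain ⟨α, hα1, hα2, hα3⟩ : ∃ α ∈ L x, α ≠ c0 r ∧
      ((∃ s, ∀ t, G.Adj p1 t → t = y1 ∨ t = s) ∨
      (G.Adj p1 x ∨ G.Adj p1 y ∨ G.Adj p1 y2) ∨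
      (p1 ∈ D0 ∧ ∃ a ∈ D0, G.Adj p1 a ∧
        (α = c0 p1 ∨ α = c0 a ∨ α ∉ L y1 ∨ c0 p1 ∉ L y1 ∨ c0 a ∉ L y1))) := by
    have h5 : 5 ≤ ((L x).erase (c0 r)).card := by
      have := Finset.pred_card_le_card_erase (s := L x) (a := c0 r)
      rw [hL] at this; exact this
    rcases hcrit with h | h | ⟨hp, a, ha, hpa⟩
    · obtain ⟨α, h'⟩ := Finset.card_pos.1 (by omega : 0 < ((L x).erase (c0 r)).card)
      rw [Finset.mem_erase] at h'
      exact ⟨α, h'.2, h'.1, Or.inl h⟩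
    · obtain ⟨α, h'⟩ := Finset.card_pos.1 (by omega : 0 < ((L x).erase (c0 r)).card)
      rw [Finset.mem_erase] at h'
      exact ⟨α, h'.2, h'.1, Or.inr (Or.inl h)⟩
    · by_contra hcon
      push Not at hcon
      have key : ∀ α ∈ (L x).erase (c0 r), α ≠ c0 p1 ∧ α ≠ c0 a ∧ α ∈ L y1 ∧
          c0 p1 ∈ L y1 ∧ c0 a ∈ L y1 := by
        intro α h'
        rw [Finset.mem_erase] at h'
        exact (hcon α h'.2 h'.1).2.2 hp a ha hpa
      obtain ⟨β, h'⟩ := Finset.card_pos.1 (by omega : 0 < ((L x).erase (c0 r)).card)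
      have hβ := key β h'
      have hne : c0 p1 ≠ c0 a := g0.1 _ _ hp ha hpa
      have hsub : insert (c0 p1) (insert (c0 a) ((L x).erase (c0 r))) ⊆ L y1 := by
        intro γ hγ
        rw [Finset.mem_insert, Finset.mem_insert] at hγ
        rcases hγ with rfl | rfl | hγ
        · exact hβ.2.2.2.1
        · exact hβ.2.2.2.2
        · exact (key γ hγ).2.2.1
      have hcard := Finset.card_le_card hsub
      have n1 : c0 a ∉ (L x).erase (c0 r) := fun h => (key _ h).2.1 rfl
      have n2 : c0 p1 ∉ insert (c0 a) ((L x).erase (c0 r)) := by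
        rw [Finset.mem_insert]; rintro (h | h)
        · exact hne h
        · exact (key _ h).1 rfl
      rw [Finset.card_insert_of_notMem n2, Finset.card_insert_of_notMem n1, hL] at hcard
      omega
  obtain ⟨c1, g1, a1, e1⟩ := goodP_step g0 x (by simp [hD0]) α hα1
    (by intro w hw hwD; grind)
    (by
      intro w hw _ u hu hwu
      rw [hx] at hw
      rcases hw with rfl | rfl | rfl
      · grind
      · grind
      · grind)
  obtain ⟨D1, hD1⟩ : ∃ D, D = insert x D0 := ⟨_, rfl⟩
  rw [← hD1] at g1
  have m1 : ∀ u, u ∈ D1 ↔ u ∈ D0 ∨ u = x := by intro u; rw [hD1, Set.mem_insert_iff, or_comm]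
  -- step z1
  have t1 : z ∉ D1 ∧ z2 ∉ D1 := by
    clear hα3 hcrit; simp only [m1, hD0]; simp [hxz.symm, nz2]
  obtain ⟨c2, g2, a2⟩ := goodP_stepF hL g1 z1 y1 (by
    intro hv hp
    obtain ⟨K, k1, k2, k3⟩ := outerK G c1 D1 q1
    refine ⟨insert (c1 x) K, (Finset.card_insert_le _ _).trans (by omega), ?_⟩
    intro w hw
    rw [hz1] at hw
    rcases hw with rfl | rfl
    · refine ⟨fun h => absurd h t1.1, fun _ u hu hwu => ?_⟩
      rcases (hz u).1 hwu with h | h | h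
      · simp [h]
      · exact absurd (h ▸ hu) hv
      · exact absurd (h ▸ hu) t1.2
    · exact ⟨fun _ => Finset.mem_insert_of_mem k2,
        fun h u hu hwu => Finset.mem_insert_of_mem (k3 h u hu hwu)⟩)
  obtain ⟨D2, hD2⟩ : ∃ D, D = D1 ∪ {u | u = z1 ∧ u ≠ y1} := ⟨_, rfl⟩
  rw [← hD2] at g2
  have m2 : ∀ u, u ∈ D2 ↔ u ∈ D1 ∨ (u = z1 ∧ u ≠ y1) := by intro u; rw [hD2]; rfl
  -- step z2
  have t2 : z ∉ D2 := by
    rw [m2]; rintro (h | h)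
    · exact t1.1 h
    · exact nz1.2.2 h.1.symm
  obtain ⟨c3, g3, a3⟩ := goodP_stepF hL g2 z2 y1 (by
    intro hv hp
    obtain ⟨K, k1, k2, k3⟩ := outerK G c2 D2 q2
    refine ⟨insert (c2 x) (insert (c2 z1) K), (Finset.card_insert_le _ _).trans
      (by have := Finset.card_insert_le (c2 z1) K; omega), ?_⟩
    intro w hw
    rw [hz2] at hw
    rcases hw with rfl | rfl
    · refine ⟨fun h => absurd h t2, fun _ u hu hwu => ?_⟩
      rcases (hz u).1 hwu with h | h | h
      · simp [h]
      · simp [h]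
      · exact absurd (h ▸ hu) hv
    · exact ⟨fun _ => Finset.mem_insert_of_mem (Finset.mem_insert_of_mem k2),
        fun h u hu hwu => Finset.mem_insert_of_mem
        (Finset.mem_insert_of_mem (k3 h u hu hwu))⟩)
  obtain ⟨D3, hD3⟩ : ∃ D, D = D2 ∪ {u | u = z2 ∧ u ≠ y1} := ⟨_, rfl⟩
  rw [← hD3] at g3
  have m3 : ∀ u, u ∈ D3 ↔ u ∈ D2 ∨ (u = z2 ∧ u ≠ y1) := by intro u; rw [hD3]; rfl
  -- step z
  have t3 : y ∉ D3 := by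
    simp only [m3, m2, m1, hD0]; simp [hxy.symm, nz1.2.1.symm, nz2.2.1.symm]
  have t3' : x1 ∈ D3 → x1 = z1 ∨ x1 = z2 := by
    simp only [m3, m2, m1, hD0]; simp [nx1.1]; tauto
  obtain ⟨c4, g4, a4⟩ := goodP_stepF hL g3 z y1 (by
    intro hv hp
    refine ⟨{c3 x, c3 z1, c3 q1, c3 z2, c3 q2}, Finset.card_le_five, ?_⟩
    intro w hw
    rcases (hz w).1 hw with e | e | e <;> subst e
    · refine ⟨fun _ => by simp, fun _ u hu hwu => ?_⟩
      rcases (hx u).1 hwu with h | h | h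
      · exact absurd (h ▸ hu) t3
      · exact absurd (h ▸ hu) hv
      · rcases t3' (h ▸ hu) with h' | h' <;> simp [h, h']
    · refine ⟨fun _ => by simp, fun _ u hu hwu => ?_⟩
      rcases (hz1 u).1 hwu with h | h
      · exact absurd (h ▸ hu) hv
      · simp [h]
    · refine ⟨fun _ => by simp, fun _ u hu hwu => ?_⟩
      rcases (hz2 u).1 hwu with h | h
      · exact absurd (h ▸ hu) hv
      · simp [h])
  obtain ⟨D4, hD4⟩ : ∃ D, D = D3 ∪ {u | u = z ∧ u ≠ y1} := ⟨_, rfl⟩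
  rw [← hD4] at g4
  have m4 : ∀ u, u ∈ D4 ↔ u ∈ D3 ∨ (u = z ∧ u ≠ y1) := by intro u; rw [hD4]; rfl
  -- step x1
  have t4 : y ∉ D4 := by
    rw [m4]; rintro (h | h)
    · exact t3 h
    · exact hyz h.1
  obtain ⟨c5, g5, a5⟩ := goodP_stepF hL g4 x1 y1 (by
    intro hv hp
    obtain ⟨K, k1, k2, k3⟩ := outerK G c4 D4 r
    refine ⟨insert (c4 x) (insert (c4 z) K), (Finset.card_insert_le _ _).trans
      (by have := Finset.card_insert_le (c4 z) K; omega), ?_⟩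
    intro w hw
    rcases (hx1 w).1 hw with e | e <;> subst e
    · refine ⟨fun _ => by simp, fun _ u hu hwu => ?_⟩
      rcases (hx u).1 hwu with h | h | h
      · exact absurd (h ▸ hu) t4
      · simp [h]
      · exact absurd (h ▸ hu) hv
    · exact ⟨fun _ => Finset.mem_insert_of_mem (Finset.mem_insert_of_mem k2),
        fun h u hu hwu => Finset.mem_insert_of_mem
        (Finset.mem_insert_of_mem (k3 h u hu hwu))⟩)
  obtain ⟨D5, hD5⟩ : ∃ D, D = D4 ∪ {u | u = x1 ∧ u ≠ y1} := ⟨_, rfl⟩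
  rw [← hD5] at g5
  have m5 : ∀ u, u ∈ D5 ↔ u ∈ D4 ∨ (u = x1 ∧ u ≠ y1) := by intro u; rw [hD5]; rfl
  have s5 : ∀ u, u ∈ D5 ↔ u ≠ y ∧ u ≠ y1 ∧ (u ≠ y2 ∨ u = z1 ∨ u = z2 ∨ u = x1) := by
    intro u
    rw [m5, m4, m3, m2, m1, hD0]
    clear hα3 hcrit hx hy hz hx1 hy1 hy2 hz1 hz2 m1 m2 m3 m4 m5 hD0 hD1 hD2 hD3 hD4 hD5 a1 a2 a3 a4 a5 t1 t2 t3 t3' t4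
    grind
  -- step y
  have t5 : y1 ∉ D5 := fun h => ((s5 _).1 h).2.1 rfl
  have t5' : y2 ∈ D5 → p2 = z ∨ p2 = x := by
    intro h2
    rcases ((s5 y2).1 h2).2.2 with h | h | h | h
    · exact absurd rfl h
    · have := (hz1 z).2 (Or.inl rfl); rw [← h, hy2] at this
      exact Or.inl (this.resolve_left hyz.symm).symm
    · have := (hz2 z).2 (Or.inl rfl); rw [← h, hy2] at this
      exact Or.inl (this.resolve_left hyz.symm).symm
    · have := (hx1 x).2 (Or.inl rfl); rw [← h, hy2] at this
      exact Or.inr (this.resolve_left hxy).symm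
  obtain ⟨c6, g6, a6⟩ := goodP_stepF hL g5 y y1 (by
    intro hv hp
    obtain ⟨s, hs1, hs2⟩ : ∃ s, (y2 ∈ D5 → c5 y2 ∈ ({c5 x, c5 z, c5 x1, c5 p1, s} : Finset ℕ)) ∧
        c5 p2 ∈ ({c5 x, c5 z, c5 x1, c5 p1, s} : Finset ℕ) := by
      by_cases h2 : y2 ∈ D5
      · refine ⟨c5 y2, fun _ => by simp, ?_⟩
        rcases t5' h2 with h | h <;> simp [h]
      · exact ⟨c5 p2, fun h => absurd h h2, by simp⟩
    refine ⟨{c5 x, c5 z, c5 x1, c5 p1, s}, Finset.card_le_five, ?_⟩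
    intro w hw
    rcases (hy w).1 hw with e | e | e <;> subst e
    · refine ⟨fun _ => by simp, fun _ u hu hwu => ?_⟩
      rcases (hx u).1 hwu with h | h | h
      · exact absurd (h ▸ hu) hv
      · simp [h]
      · simp [h]
    · refine ⟨fun h => absurd h t5, fun _ u hu hwu => ?_⟩
      rcases (hy1 u).1 hwu with h | h
      · exact absurd (h ▸ hu) hv
      · simp [h]
    · refine ⟨hs1, fun _ u hu hwu => ?_⟩
      rcases (hy2 u).1 hwu with h | h
      · exact absurd (h ▸ hu) hv
      · rw [h]; exact hs2)
  obtain ⟨D6, hD6⟩ : ∃ D, D = D5 ∪ {u | u = y ∧ u ≠ y1} := ⟨_, rfl⟩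
  rw [← hD6] at g6
  have m6 : ∀ u, u ∈ D6 ↔ u ∈ D5 ∨ (u = y ∧ u ≠ y1) := by intro u; rw [hD6]; rfl
  -- step y2
  have t6 : y1 ∉ D6 := by
    rw [m6]; rintro (h | h)
    · exact t5 h
    · exact h.2 rfl
  obtain ⟨c7, g7, a7⟩ := goodP_stepF hL g6 y2 y1 (by
    intro hv hp
    obtain ⟨K, k1, k2, k3⟩ := outerK G c6 D6 p2
    refine ⟨insert (c6 y) (insert (c6 x) K), (Finset.card_insert_le _ _).trans
      (by have := Finset.card_insert_le (c6 x) K; omega), ?_⟩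
    intro w hw
    rcases (hy2 w).1 hw with e | e <;> subst e
    · refine ⟨fun _ => by simp, fun _ u hu hwu => ?_⟩
      rcases (hy u).1 hwu with h | h | h
      · simp [h]
      · exact absurd (h ▸ hu) t6
      · exact absurd (h ▸ hu) hv
    · exact ⟨fun _ => Finset.mem_insert_of_mem (Finset.mem_insert_of_mem k2),
        fun h u hu hwu => Finset.mem_insert_of_mem
        (Finset.mem_insert_of_mem (k3 h u hu hwu))⟩)
  obtain ⟨D7, hD7⟩ : ∃ D, D = D6 ∪ {u | u = y2 ∧ u ≠ y1} := ⟨_, rfl⟩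
  rw [← hD7] at g7
  have m7 : ∀ u, u ∈ D7 ↔ u ∈ D6 ∨ (u = y2 ∧ u ≠ y1) := by intro u; rw [hD7]; rfl
  have s7 : ∀ u, u ∈ D7 ↔ u ≠ y1 := by
    intro u; rw [m7, m6, s5]
    clear * - ny1 ny2 hyy
    grind
  have agree : ∀ u ∈ D1, c7 u = c1 u := by
    intro u hu
    have h2 := (m2 u).2 (Or.inl hu)
    have h3 := (m3 u).2 (Or.inl h2)
    have h4 := (m4 u).2 (Or.inl h3)
    have h5 := (m5 u).2 (Or.inl h4)
    have h6 := (m6 u).2 (Or.inl h5)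
    rw [a7 u h6, a6 u h5, a5 u h4, a4 u h3, a3 u h2, a2 u hu]
  have agree0 : ∀ u ∈ D0, c7 u = c0 u := by
    intro u hu
    rw [agree u ((m1 u).2 (Or.inl hu)), a1 u hu]
  have agx : c7 x = α := by rw [agree x ((m1 x).2 (Or.inr rfl)), e1]
  -- last step
  obtain ⟨β, hβ, hβy, hβx, hβ2, hβp, hβs⟩ : ∃ β ∈ L y1, β ≠ c7 y ∧ β ≠ c7 x ∧ β ≠ c7 y2 ∧
      β ≠ c7 p1 ∧ ((c7 '' {u | G.Adj p1 u ∧ u ∈ D7}).ncard < 3 →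
        ∀ u ∈ D7, G.Adj p1 u → c7 u ≠ β) := by
    by_cases hlt : (c7 '' {u | G.Adj p1 u ∧ u ∈ D7}).ncard < 3
    swap
    · obtain ⟨β, h1, h2⟩ : ∃ β ∈ L y1, β ∉ ({c7 y, c7 x, c7 y2, c7 p1} : Finset ℕ) := by
        apply Finset.exists_mem_notMem_of_card_lt_card
        rw [hL]
        have : ({c7 y, c7 x, c7 y2, c7 p1} : Finset ℕ).card ≤ 4 := Finset.card_le_four
        omega
      simp only [Finset.mem_insert, Finset.mem_singleton, not_or] at h2
      exact ⟨β, h1, h2.1, h2.2.1, h2.2.2.1, h2.2.2.2, fun h => absurd h hlt⟩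
    obtain ⟨S, hS⟩ : ∃ S : Finset ℕ, S = (c7 '' {u | G.Adj p1 u ∧ u ∈ D7}).toFinset := ⟨_, rfl⟩
    have hSc : S.card ≤ 2 := by rw [hS, ← Set.ncard_eq_toFinset_card']; omega
    have hSm : ∀ u ∈ D7, G.Adj p1 u → c7 u ∈ S := by
      intro u hu hpu
      rw [hS, Set.mem_toFinset]; exact ⟨u, ⟨hpu, hu⟩, rfl⟩
    -- reduce to finding a set
    have red : ∀ F : Finset ℕ, F.card ≤ 5 → (∀ γ ∈ L y1, γ = c7 y ∨ γ = c7 x ∨ γ = c7 y2 ∨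
        γ = c7 p1 ∨ (∃ u ∈ D7, G.Adj p1 u ∧ c7 u = γ) → γ ∈ F) →
        ∃ β ∈ L y1, β ≠ c7 y ∧ β ≠ c7 x ∧ β ≠ c7 y2 ∧
      β ≠ c7 p1 ∧ ((c7 '' {u | G.Adj p1 u ∧ u ∈ D7}).ncard < 3 →
        ∀ u ∈ D7, G.Adj p1 u → c7 u ≠ β) := by
      intro F hF hFm
      obtain ⟨β, h1, h2⟩ : ∃ β ∈ L y1, β ∉ F := by
        apply Finset.exists_mem_notMem_of_card_lt_card
        rw [hL]; omega
      have h3 := mt (hFm β h1) h2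
      push Not at h3
      exact ⟨β, h1, h3.1, h3.2.1, h3.2.2.1, h3.2.2.2.1, fun _ => h3.2.2.2.2⟩
    have tri : ∀ (a b d : ℕ) , (insert a (insert b (insert d S))).card ≤ 5 := by
      intro a b d
      have h1 := Finset.card_insert_le a (insert b (insert d S))
      have h2 := Finset.card_insert_le b (insert d S)
      have h3 := Finset.card_insert_le d S
      omega
    have quad : ∀ (a b d e : ℕ) , (insert a (insert b (insert d (insert e S)))).card ≤ 6 := by
      intro a b d e
      have h1 := Finset.card_insert_le a (insert b (insert d (insert e S)))
      have h2 := tri b d e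
      omega
    rcases hα3 with ⟨s, hs⟩ | hadj | ⟨hp, a, ha, hpa, hor⟩
    · refine red {c7 y, c7 x, c7 y2, c7 p1, c7 s} Finset.card_le_five ?_
      rintro γ hγ (h | h | h | h | ⟨u, hu, hpu, h⟩)
      · simp [h]
      · simp [h]
      · simp [h]
      · simp [h]
      · rcases hs u hpu with h' | h'
        · exact absurd h' ((s7 u).1 hu)
        · simp [← h, h']
    · rcases hadj with h' | h' | h'
      · have := hSm x ((s7 x).2 ny1.1.symm) h'
        refine red _ (tri (c7 y) (c7 y2) (c7 p1)) ?_
        rintro γ hγ (h | h | h | h | ⟨u, hu, hpu, h⟩)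
        · simp [h]
        · simp [h, this]
        · simp [h]
        · simp [h]
        · have := hSm u hu hpu; simp [← h, this]
      · have := hSm y ((s7 y).2 ny1.2.1.symm) h'
        refine red _ (tri (c7 x) (c7 y2) (c7 p1)) ?_
        rintro γ hγ (h | h | h | h | ⟨u, hu, hpu, h⟩)
        · simp [h, this]
        · simp [h]
        · simp [h]
        · simp [h]
        · have := hSm u hu hpu; simp [← h, this]
      · have := hSm y2 ((s7 y2).2 hyy.symm) h'
        refine red _ (tri (c7 x) (c7 y) (c7 p1)) ?_
        rintro γ hγ (h | h | h | h | ⟨u, hu, hpu, h⟩)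
        · simp [h]
        · simp [h]
        · simp [h, this]
        · simp [h]
        · have := hSm u hu hpu; simp [← h, this]
    · have ha7 : a ∈ D7 := (s7 a).2 ((hD0 a).1 ha).2.2.2.2.1
      have haS := hSm a ha7 hpa
      by_cases hx' : c7 x = c7 p1 ∨ c7 x = c7 a
      · refine red _ (tri (c7 y) (c7 y2) (c7 p1)) ?_
        rintro γ hγ (h | h | h | h | ⟨u, hu, hpu, h⟩)
        · simp [h]
        · rcases hx' with h' | h' <;> simp [h, h', haS]
        · simp [h]
        · simp [h]
        · have := hSm u hu hpu; simp [← h, this]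
      · have : ∃ β, β ∉ L y1 ∧ β ∈ insert (c7 y) (insert (c7 x) (insert (c7 y2)
            (insert (c7 p1) S))) := by
          rw [← agree0 p1 hp, ← agree0 a ha, ← agx] at hor
          rcases hor with h | h | h | h | h
          · exact absurd (Or.inl h) hx'
          · exact absurd (Or.inr h) hx'
          · exact ⟨_, h, by simp⟩
          · exact ⟨_, h, by simp⟩
          · exact ⟨_, h, by simp [haS]⟩
        obtain ⟨β, hb1, hb2⟩ := this
        refine red ((insert (c7 y) (insert (c7 x) (insert (c7 y2)
            (insert (c7 p1) S)))).erase β) ?_ ?_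
        · rw [Finset.card_erase_of_mem hb2]
          have := quad (c7 y) (c7 x) (c7 y2) (c7 p1)
          omega
        · rintro γ hγ hh
          rw [Finset.mem_erase]
          refine ⟨by rintro rfl; exact hb1 hγ, ?_⟩
          rcases hh with h | h | h | h | ⟨u, hu, hpu, h⟩
          · simp [h]
          · simp [h]
          · simp [h]
          · simp [h]
          · have := hSm u hu hpu; simp [← h, this]
  obtain ⟨c8, g8, -, -⟩ := goodP_step g7 y1 (by simp [s7]) β hβ
    (by
      intro w hw _
      rw [hy1] at hw
      rcases hw with rfl | rfl
      · exact hβy.symm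
      · exact hβp.symm)
    (by
      intro w hw hlt u hu hwu
      rw [hy1] at hw
      rcases hw with rfl | rfl
      · rw [hy] at hwu
        rcases hwu with rfl | rfl | rfl
        · exact hβx.symm
        · exact absurd rfl ((s7 _).1 hu)
        · exact hβ2.symm
      · exact hβs hlt u hu hwu)
  refine goodP_fin (fun v => ?_) g8
  by_cases h : v = y1
  · exact Or.inl h
  · exact Or.inr ((s7 v).2 h)

set_option maxHeartbeats 1000000 in
theorem min_counterexample_W1_not_two_W2_neighbors {V : Type*} [Fintype V]
    (G : SimpleGraph V) (hmad : MadLT G (18 / 7)) (hG : ¬ Ch3dLE G 6)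
    (hmin : ProperSubgraphsCh3dLE G 6) :
    ∀ x : V, Wmem G 1 x →
      ¬ ∃ y z : V, y ≠ z ∧ G.Adj x y ∧ G.Adj x z ∧ Wmem G 2 y ∧ Wmem G 2 z := by
  intro x hx
  rintro ⟨y, z, hyz, hxy, hxz, hy, hz⟩
  apply hG
  intro L' hL'
  choose L hLs hL using fun v => Finset.exists_subset_card_eq (hL' v)
  suffices h : Dyn3ListColorable G L by
    obtain ⟨φ, h1, h2⟩ := h
    exact ⟨φ, h1, fun v => hLs v (h2 v)⟩
  have dx := hx.1
  have dy := hy.1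
  have dz := hz.1
  obtain ⟨x1, dx1, nx⟩ := one_struct hx y z hyz hxy hxz dy dz
  obtain ⟨y1, y2, hyy, dy1, dy2, ny⟩ := three_struct hy x hxy.symm dx
  obtain ⟨z1, z2, hzz, dz1, dz2, nz⟩ := three_struct hz x hxz.symm dx
  obtain ⟨r, hr, nx1⟩ := two_struct dx1 ((nx x1).2 (by simp)).symm
  obtain ⟨p1, hp1, ny1⟩ := two_struct dy1 ((ny y1).2 (by simp)).symm
  obtain ⟨p2, hp2, ny2⟩ := two_struct dy2 ((ny y2).2 (by simp)).symm
  obtain ⟨q1, hq1, nz1⟩ := two_struct dz1 ((nz z1).2 (by simp)).symm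
  obtain ⟨q2, hq2, nz2⟩ := two_struct dz2 ((nz z2).2 (by simp)).symm
  have leaf : ∀ a, (G.neighborSet a).ncard = 2 → a ≠ x ∧ a ≠ y ∧ a ≠ z := by
    intro a ha
    refine ⟨?_, ?_, ?_⟩ <;> rintro rfl <;> omega
  obtain ⟨D0, hD0⟩ : ∃ D : Set V, ∀ u, u ∈ D ↔ u ≠ x ∧ u ≠ y ∧ u ≠ z ∧ u ≠ x1 ∧ u ≠ y1 ∧
      u ≠ y2 ∧ u ≠ z1 ∧ u ≠ z2 :=
    ⟨{u | u ≠ x ∧ u ≠ y ∧ u ≠ z ∧ u ≠ x1 ∧ u ≠ y1 ∧ u ≠ y2 ∧ u ≠ z1 ∧ u ≠ z2}, fun u => Iff.rfl⟩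
  by_cases c1 : (∃ s, ∀ t, G.Adj p1 t → t = y1 ∨ t = s) ∨
      (G.Adj p1 x ∨ G.Adj p1 y ∨ G.Adj p1 y2) ∨ (p1 ∈ D0 ∧ ∃ a ∈ D0, G.Adj p1 a)
  · exact core hmin L hL x y z x1 y1 y2 z1 z2 r p1 p2 q1 q2 nx ny nz nx1 ny1 ny2 nz1 nz2
      hxy.ne hxz.ne hyz (leaf _ dx1) (leaf _ dy1) (leaf _ dy2) (leaf _ dz1) (leaf _ dz2) hyy hzz
      D0 hD0 c1
  by_cases c2 : (∃ s, ∀ t, G.Adj p2 t → t = y2 ∨ t = s) ∨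
      (G.Adj p2 x ∨ G.Adj p2 y ∨ G.Adj p2 y1) ∨ (p2 ∈ D0 ∧ ∃ a ∈ D0, G.Adj p2 a)
  · exact core hmin L hL x y z x1 y2 y1 z1 z2 r p2 p1 q1 q2 nx (fun t => (ny t).trans (by clear * -; tauto))
      nz nx1 ny2 ny1 nz1 nz2
      hxy.ne hxz.ne hyz (leaf _ dx1) (leaf _ dy2) (leaf _ dy1) (leaf _ dz1) (leaf _ dz2) hyy.symm
      hzz D0 (fun u => (hD0 u).trans (by clear * -; tauto)) c2
  exfalso
  have lx1 := leaf _ dx1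
  have ly1 := leaf _ dy1
  have ly2 := leaf _ dy2
  have lz1 := leaf _ dz1
  have lz2 := leaf _ dz2
  have sym : ∀ a b, G.Adj a b → G.Adj b a := fun a b h => h.symm
  have hxy' := hxy.ne
  have hxz' := hxz.ne
  -- the outer neighbors lie outside
  have gen : ∀ yi yj p, (∀ t, G.Adj yi t ↔ t = y ∨ t = p) → p ≠ y →
      (yi = y1 ∧ yj = y2 ∨ yi = y2 ∧ yj = y1) →
      ¬ ((∃ s, ∀ t, G.Adj p t → t = yi ∨ t = s) ∨
      (G.Adj p x ∨ G.Adj p y ∨ G.Adj p yj) ∨ (p ∈ D0 ∧ ∃ a ∈ D0, G.Adj p a)) →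
      p ∈ D0 ∧ ∀ t, G.Adj p t → t = yi ∨ t = x1 ∨ t = z1 ∨ t = z2 := by
    intro yi yj p hyi hpy hij hc
    push Not at hc
    obtain ⟨k1, ⟨k2, k3, k4⟩, k5⟩ := hc
    have two : ∀ a b, (∀ t, G.Adj p t ↔ t = a ∨ t = b) → False := by
      intro a b h
      have hpi : G.Adj p yi := ((hyi p).2 (Or.inr rfl)).symm
      rcases (h yi).1 hpi with e | e
      · obtain ⟨t, h1, h2, h3⟩ := k1 b
        rcases (h t).1 h1 with h | h
        · exact h2 (h.trans e.symm)
        · exact h3 h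
      · obtain ⟨t, h1, h2, h3⟩ := k1 a
        rcases (h t).1 h1 with h | h
        · exact h3 h
        · exact h2 (h.trans e.symm)
    have hp : p ∈ D0 := by
      rw [hD0]
      refine ⟨?_, hpy, ?_, ?_, ?_, ?_, ?_, ?_⟩
      · rintro rfl; exact k3 hxy
      · rintro rfl; exact k2 hxz.symm
      · rintro rfl; exact two _ _ nx1
      · rintro rfl; exact two _ _ ny1
      · rintro rfl; exact two _ _ ny2
      · rintro rfl; exact two _ _ nz1
      · rintro rfl; exact two _ _ nz2
    refine ⟨hp, fun t ht => ?_⟩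
    have h1 := fun h => k5 hp t h ht
    rw [hD0] at h1 hp
    have h2 : t ≠ z := by
      rintro rfl
      have := (nz p).1 ht.symm
      rcases this with h | h | h
      · exact hp.1 h
      · exact hp.2.2.2.2.2.2.1 h
      · exact hp.2.2.2.2.2.2.2 h
    by_contra hcon
    push Not at hcon
    apply h1
    refine ⟨?_, ?_, h2, hcon.2.1, ?_, ?_, hcon.2.2.1, hcon.2.2.2⟩
    · rintro rfl; exact k2 ht
    · rintro rfl; exact k3 ht
    · rintro rfl; rcases hij with ⟨h, h'⟩ | ⟨h, h'⟩
      · exact hcon.1 h.symm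
      · exact k4 (h' ▸ ht)
    · rintro rfl; rcases hij with ⟨h, h'⟩ | ⟨h, h'⟩
      · exact k4 (h' ▸ ht)
      · exact hcon.1 h.symm
  obtain ⟨P1, Q1⟩ := gen y1 y2 p1 ny1 hp1 (Or.inl ⟨rfl, rfl⟩) c1
  obtain ⟨P2, Q2⟩ := gen y2 y1 p2 ny2 hp2 (Or.inr ⟨rfl, rfl⟩) c2
  have hpp : p1 ≠ p2 := by
    intro h
    apply c1
    refine Or.inr (Or.inl (Or.inr (Or.inr ?_)))
    rw [h]; exact ((ny2 p2).2 (Or.inr rfl)).symm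
  -- a vertex among x1, z1, z2 is adjacent to at most one of p1, p2
  have nocom : ∀ u, u = x1 ∨ u = z1 ∨ u = z2 → ¬ (G.Adj p1 u ∧ G.Adj p2 u) := by
    rw [hD0] at P1 P2
    rintro u hu ⟨h1, h2⟩
    have h1 := h1.symm
    have h2 := h2.symm
    rcases hu with rfl | rfl | rfl
    · rw [nx1] at h1 h2; clear * - h1 h2 P1 P2 hpp; grind
    · rw [nz1] at h1 h2; clear * - h1 h2 P1 P2 hpp; grind
    · rw [nz2] at h1 h2; clear * - h1 h2 P1 P2 hpp; grind
  push Not at c1 c2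
  have k1 := c1.1
  have k2 := c2.1
  obtain ⟨t1, h11, h12, -⟩ := k1 y1
  obtain ⟨t2, h21, h22, h23⟩ := k1 t1
  obtain ⟨t3, h31, h32, -⟩ := k2 y2
  obtain ⟨t4, h41, h42, h43⟩ := k2 t3
  have b1 := Q1 _ h11
  have b2 := Q1 _ h21
  have b3 := Q2 _ h31
  have b4 := Q2 _ h41
  have ne13 : t1 ≠ t3 := fun h => nocom t1 (b1.resolve_left h12) ⟨h11, h ▸ h31⟩
  have ne14 : t1 ≠ t4 := fun h => nocom t1 (b1.resolve_left h12) ⟨h11, h ▸ h41⟩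
  have ne23 : t2 ≠ t3 := fun h => nocom t2 (b2.resolve_left h22) ⟨h21, h ▸ h31⟩
  have ne24 : t2 ≠ t4 := fun h => nocom t2 (b2.resolve_left h22) ⟨h21, h ▸ h41⟩
  clear * - b1 b2 b3 b4 ne13 ne14 ne23 ne24 h12 h22 h23 h32 h42 h43
  grind
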